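/- Let φ ∈ C_c^∞(ℝ) with supp φ ⊆ [a, b] where 0 < a < b < ∞, and let σ be a symbol of class S⁰. For every L > 1 there exists a constant C_L > 0, depending only on φ, σ and L, such that for all μ ∈ ℝ and all δ, ε > 0 with 0 < ε ≤ δ and dist(μ, ℤ) ≥ δ, one has |∑_{k ∈ ℤ} e^{2πi μ k} φ(εk) σ(k)| ≤ C_L · max(ε^{L−1}/δ^L, 1). -/

import Mathlib

open Real

lemma psum_summable (z : ℂ) (A B : ℝ) (f : ℝ → ℂ) (hs : Function.support f ⊆ Set.Icc A B) :
    ∀ k : ℤ, k ∉ Finset.Icc ⌈A⌉ ⌊B⌋ → z ^ k * f k = 0 := by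
  intro k hk
  have : f k = 0 := by
    by_contra h
    have := hs h
    apply hk
    rw [Finset.mem_Icc]
    exact ⟨Int.ceil_le.2 this.1, Int.le_floor.2 this.2⟩
  simp [this]

lemma psum_bound (z : ℂ) (hz : ‖z‖ = 1) (N : ℕ) : ∀ (A B M : ℝ) (f : ℝ → ℂ), A ≤ B →
    ContDiff ℝ (⊤ : ℕ∞) f → Function.support f ⊆ Set.Icc A B →
    (∀ x, ‖iteratedDeriv N f x‖ ≤ M) →
    ‖z - 1‖ ^ N * ‖∑' k : ℤ, z ^ k * f k‖ ≤ M * (B - A + N + 1) := by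
  have hz0 : z ≠ 0 := by
    rintro rfl
    simp at hz
  induction N with
  | zero =>
    intro A B M f hAB hf hs hM
    have hM0 : 0 ≤ M := (norm_nonneg _).trans (hM 0)
    rw [tsum_eq_sum (psum_summable z A B f hs)]
    have h1 : ‖∑ k ∈ Finset.Icc ⌈A⌉ ⌊B⌋, z ^ k * f k‖ ≤ ∑ k ∈ Finset.Icc ⌈A⌉ ⌊B⌋, M := by
      refine norm_sum_le_of_le _ fun k _ => ?_
      simpa [hz] using hM k
    rw [Finset.sum_const, Int.card_Icc, nsmul_eq_mul] at h1
    have h2 : (((⌊B⌋ + 1 - ⌈A⌉).toNat : ℕ) : ℝ) ≤ B - A + 1 := by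
      have h3 : (((⌊B⌋ + 1 - ⌈A⌉).toNat : ℕ) : ℝ) = ((max (⌊B⌋ + 1 - ⌈A⌉) 0 : ℤ) : ℝ) := by
        rw [← Int.toNat_eq_max, Int.cast_natCast]
      rw [h3]
      push_cast
      apply max_le
      · linarith [Int.floor_le B, Int.le_ceil A]
      · linarith
    simp only [pow_zero, one_mul, Nat.cast_zero, add_zero]
    nlinarith
  | succ N ih =>
    intro A B M f hAB hf hs hM
    set g : ℝ → ℂ := fun x => f (x + 1) - f x with hg
    have hf1 : ContDiff ℝ (⊤ : ℕ∞) (fun x => f (x + 1)) := hf.comp (by fun_prop)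
    have hs1 : Function.support (fun x => f (x + 1)) ⊆ Set.Icc (A - 1) (B - 1) := by
      intro x hx
      have := hs (show x + 1 ∈ Function.support f from hx)
      exact ⟨by linarith [this.1], by linarith [this.2]⟩
    have hgs : Function.support g ⊆ Set.Icc (A - 1) B := by
      intro x hx
      by_contra h
      apply hx
      have h1 : f (x + 1) = 0 := by
        by_contra h'
        have := hs1 (show x ∈ Function.support (fun x => f (x + 1)) from h')
        exact h ⟨this.1, by linarith [this.2]⟩
      have h2 : f x = 0 := by
        by_contra h'
        have := hs h'
        exact h ⟨by linarith [this.1], this.2⟩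
      simp [hg, h1, h2]
    have hgM : ∀ x, ‖iteratedDeriv N g x‖ ≤ M := by
      intro x
      have h1 : iteratedDeriv N g x = iteratedDeriv N f (x + 1) - iteratedDeriv N f x := by
        rw [hg, iteratedDeriv_fun_sub, iteratedDeriv_comp_add_const]
        · exact (hf1.of_le (by exact_mod_cast le_top)).contDiffAt
        · exact (hf.of_le (by exact_mod_cast le_top)).contDiffAt
      rw [h1]
      have hd : Differentiable ℝ (iteratedDeriv N f) :=
        hf.differentiable_iteratedDeriv N (by exact_mod_cast ENat.coe_lt_top N)
      have := Convex.norm_image_sub_le_of_norm_deriv_le (f := iteratedDeriv N f) (C := M)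
        (s := Set.univ) (x := x) (y := x + 1) (fun y _ => hd y)
        (fun y _ => by rw [← iteratedDeriv_succ]; exact hM y) convex_univ trivial trivial
      simpa using this
    have key := ih (A - 1) B M g (by linarith) (hf1.sub hf) hgs hgM
    have hS : Summable fun k : ℤ => z ^ k * f k :=
      summable_of_ne_finset_zero (psum_summable z A B f hs)
    have hS1 : Summable fun k : ℤ => z ^ k * f ((k : ℝ) + 1) :=
      summable_of_ne_finset_zero (psum_summable z _ _ _ hs1)
    have hsh : z * ∑' k : ℤ, z ^ k * f ((k : ℝ) + 1) = ∑' k : ℤ, z ^ k * f k := by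
      rw [← tsum_mul_left, ← (Equiv.addRight (1 : ℤ)).tsum_eq (fun k : ℤ => z ^ k * f k)]
      refine tsum_congr fun k => ?_
      simp only [Equiv.coe_addRight, zpow_add₀ hz0, zpow_one]
      push_cast
      ring
    have hgt : z * ∑' k : ℤ, z ^ k * g k = -(z - 1) * ∑' k : ℤ, z ^ k * f k := by
      have : ∑' k : ℤ, z ^ k * g k
          = ∑' k : ℤ, z ^ k * f ((k : ℝ) + 1) - ∑' k : ℤ, z ^ k * f k := by
        rw [← hS1.tsum_sub hS]
        refine tsum_congr fun k => ?_
        simp only [hg]; ring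
      rw [this, mul_sub, hsh]; ring
    have hn := congrArg norm hgt
    rw [norm_mul, norm_mul, norm_neg, hz, one_mul] at hn
    rw [hn] at key
    push_cast
    calc _ = ‖z - 1‖ ^ N * (‖z - 1‖ * ‖∑' k : ℤ, z ^ k * f k‖) := by ring
      _ ≤ _ := key
      _ = _ := by ring

lemma exp_lower (μ δ : ℝ) (h : ∀ m : ℤ, δ ≤ |μ - m|) :
    δ ≤ ‖Complex.exp (2 * Real.pi * Complex.I * μ) - 1‖ := by
  have h1 : Complex.exp (2 * Real.pi * Complex.I * μ)
      = Complex.exp (Complex.I * ((2 * π * (μ - round μ) : ℝ) : ℂ)) := by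
    rw [Complex.exp_eq_exp_iff_exists_int]
    refine ⟨round μ, ?_⟩
    push_cast; ring
  rw [h1, Complex.norm_exp_I_mul_ofReal_sub_one]
  have h2 : 2 * π * (μ - round μ) / 2 = π * (μ - round μ) := by ring
  have h3 := abs_sub_round μ
  have hp := Real.pi_pos
  have h4 := Real.mul_abs_le_abs_sin (x := π * (μ - round μ)) (by
    rw [abs_mul, abs_of_pos hp]; nlinarith)
  rw [abs_mul, abs_of_pos hp] at h4
  have h5 : 2 / π * (π * |μ - round μ|) = 2 * |μ - round μ| := by field_simp
  rw [h2, norm_mul, Real.norm_eq_abs, Real.norm_eq_abs, abs_two]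
  have := h (round μ)
  have := abs_nonneg (μ - round μ)
  linarith

lemma deriv_bound (a b : ℝ) (ha : 0 < a)
    (ψ : ℝ → ℂ) (hψ : ContDiff ℝ (⊤ : ℕ∞) ψ) (hsupp : Function.support ψ ⊆ Set.Icc a b)
    (σ : ℝ → ℂ) (hσ : ContDiff ℝ (⊤ : ℕ∞) σ)
    (hσb : ∀ j : ℕ, ∃ Cj : ℝ, ∀ x : ℝ,
      ‖iteratedDeriv j σ x‖ ≤ Cj * (1 + |x|) ^ (-(j : ℝ))) (N : ℕ) :
    ∃ K : ℝ, 0 ≤ K ∧ ∀ ε : ℝ, 0 < ε → ∀ x,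
      ‖iteratedDeriv N (fun x => ψ (ε * x) * σ x) x‖ ≤ K * ε ^ N := by
  choose C hC using hσb
  have hC0 : ∀ j, 0 ≤ C j := fun j => by simpa using (norm_nonneg _).trans (hC j 0)
  have hts : tsupport ψ ⊆ Set.Icc a b := closure_minimal hsupp isClosed_Icc
  have hcs : HasCompactSupport ψ := isCompact_Icc.of_isClosed_subset isClosed_closure hts
  have hD : ∀ i : ℕ, ∃ D : ℝ, ∀ x, ‖iteratedDeriv i ψ x‖ ≤ D := by
    intro i
    obtain ⟨D, hD⟩ := (hcs.iteratedFDeriv (𝕜 := ℝ) i).exists_bound_of_continuous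
      (hψ.continuous_iteratedFDeriv (by exact_mod_cast le_top))
    exact ⟨D, fun x => by rw [← norm_iteratedFDeriv_eq_norm_iteratedDeriv]; exact hD x⟩
  choose D hD using hD
  have hD0 : ∀ j, 0 ≤ D j := fun j => (norm_nonneg _).trans (hD j 0)
  have hvan : ∀ i x, x ∉ Set.Icc a b → iteratedDeriv i ψ x = 0 := by
    intro i x hx
    by_contra h
    apply hx
    apply hts
    apply support_iteratedFDeriv_subset (𝕜 := ℝ) i
    intro h'
    apply h
    rw [← norm_eq_zero, ← norm_iteratedFDeriv_eq_norm_iteratedDeriv, h', norm_zero]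
  refine ⟨∑ i ∈ Finset.range (N + 1), (N.choose i : ℝ) * D i * (C (N - i) * (a⁻¹) ^ (N - i)),
    Finset.sum_nonneg fun i _ => by have := hD0 i; have := hC0 (N - i); positivity, ?_⟩
  intro ε hε x
  have hψε : ContDiff ℝ (⊤ : ℕ∞) (fun x => ψ (ε * x)) := hψ.comp (by fun_prop)
  rw [iteratedDeriv_fun_mul (hψε.of_le (by exact_mod_cast le_top)).contDiffAt
    (hσ.of_le (by exact_mod_cast le_top)).contDiffAt, Finset.sum_mul]
  refine norm_sum_le_of_le _ fun i hi => ?_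
  have hiN : i ≤ N := Nat.lt_succ_iff.1 (Finset.mem_range.1 hi)
  rw [iteratedDeriv_comp_const_smul (hψ.of_le (by exact_mod_cast le_top))]
  have := hD0 i
  have := hC0 (N - i)
  by_cases hx : ε * x ∈ Set.Icc a b
  · have hx1 : a / ε ≤ x := by rw [div_le_iff₀ hε]; linarith [hx.1]
    have hae : 0 < a / ε := by positivity
    have h1 : ‖iteratedDeriv (N - i) σ x‖ ≤ C (N - i) * (a⁻¹ * ε) ^ (N - i) := by
      refine (hC (N - i) x).trans ?_
      gcongr
      rw [Real.rpow_neg (by positivity), Real.rpow_natCast, ← inv_pow]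
      gcongr
      calc (1 + |x|)⁻¹ ≤ (a / ε)⁻¹ := by
            gcongr
            linarith [le_abs_self x]
        _ = a⁻¹ * ε := by field_simp
    rw [norm_mul, norm_mul, norm_smul, norm_pow, Real.norm_of_nonneg hε.le]
    have hch : ‖((N.choose i : ℕ) : ℂ)‖ = (N.choose i : ℝ) := by simp
    rw [hch]
    calc _ ≤ (N.choose i : ℝ) * (ε ^ i * D i) * (C (N - i) * (a⁻¹ * ε) ^ (N - i)) := by
          gcongr
          exact hD i _
      _ = (N.choose i : ℝ) * D i * (C (N - i) * a⁻¹ ^ (N - i)) * (ε ^ i * ε ^ (N - i)) := by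
          rw [mul_pow]; ring
      _ = _ := by rw [← pow_add, Nat.add_sub_cancel' hiN]
  · simp only [hvan i _ hx, smul_zero, mul_zero, zero_mul, norm_zero]
    positivity

/-- Poisson-summation estimate with a symbol: for a smooth cut-off `φ` supported in `[a,b]`,
`0 < a < b`, a symbol `σ` of class `S⁰`, and any `L > 1`, there is `C_L > 0` such that for all
`μ ∈ ℝ` and `0 < ε ≤ δ` with `dist(μ, ℤ) ≥ δ`, one has
`|∑_{k∈ℤ} e^{2πiμk} φ(εk) σ(k)| ≤ C_L max(ε^{L−1}/δ^L, 1)`. -/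
theorem poisson_sum_estimate_symbol (a b : ℝ) (ha : 0 < a) (hab : a < b)
    (φ : ℝ → ℝ) (hφ : ContDiff ℝ (⊤ : ℕ∞) φ) (hsupp : Function.support φ ⊆ Set.Icc a b)
    (σ : ℝ → ℂ) (hσ : ContDiff ℝ (⊤ : ℕ∞) σ)
    (hσb : ∀ j : ℕ, ∃ Cj : ℝ, ∀ x : ℝ,
      ‖iteratedDeriv j σ x‖ ≤ Cj * (1 + |x|) ^ (-(j : ℝ)))
    (L : ℝ) (hL : 1 < L) :
    ∃ C : ℝ, 0 < C ∧ ∀ μ δ ε : ℝ, 0 < ε → ε ≤ δ →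
      (∀ m : ℤ, δ ≤ |μ - m|) →
      ‖∑' k : ℤ, Complex.exp (2 * Real.pi * Complex.I * μ * k) * (φ (ε * k) : ℂ) * σ k‖
        ≤ C * max (ε ^ (L - 1) / δ ^ L) 1 := by
  obtain ⟨N, hN⟩ := exists_nat_ge L
  have hψ : ContDiff ℝ (⊤ : ℕ∞) (fun x => (φ x : ℂ)) := Complex.ofRealCLM.contDiff.comp hφ
  have hψs : Function.support (fun x => (φ x : ℂ)) ⊆ Set.Icc a b := fun x hx =>
    hsupp (fun h => hx (by simp [h]))
  obtain ⟨K, hK0, hK⟩ := deriv_bound a b ha _ hψ hψs σ hσ hσb N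
  refine ⟨K * (b - a + N + 1) + 1, by have := sub_pos.2 hab; positivity, ?_⟩
  intro μ δ ε hε hεδ hδ
  have hδ0 : 0 < δ := hε.trans_le hεδ
  have hba := sub_pos.2 hab
  have hε1 : ε ≤ 1 := by
    have := hδ (round μ)
    have := abs_sub_round μ
    linarith
  set z := Complex.exp (2 * Real.pi * Complex.I * μ) with hz
  have hz1 : ‖z‖ = 1 := by
    rw [hz, Complex.norm_exp]; simp
  set f : ℝ → ℂ := fun x => (φ (ε * x) : ℂ) * σ x with hf
  have hfc : ContDiff ℝ (⊤ : ℕ∞) f := (hψ.comp (by fun_prop : ContDiff ℝ _ (fun x => ε * x))).mul hσ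
  have hfs : Function.support f ⊆ Set.Icc (a / ε) (b / ε) := by
    intro x hx
    have : ε * x ∈ Set.Icc a b := hsupp (fun h => hx (by simp [hf, h]))
    exact ⟨by rw [div_le_iff₀ hε]; linarith [this.1], by rw [le_div_iff₀ hε]; linarith [this.2]⟩
  have key := psum_bound z hz1 N (a / ε) (b / ε) (K * ε ^ N) f (by gcongr) hfc hfs (hK ε hε)
  have hsum : ∑' k : ℤ, Complex.exp (2 * Real.pi * Complex.I * μ * k) * (φ (ε * k) : ℂ) * σ k
      = ∑' k : ℤ, z ^ k * f k := by
    refine tsum_congr fun k => ?_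
    rw [hz, ← Complex.exp_int_mul, mul_comm (k : ℂ)]
    simp only [hf, mul_assoc, Complex.ofReal_intCast]
  rw [hsum]
  have hlow := exp_lower μ δ hδ
  rw [← hz] at hlow
  have h1 : δ ^ N * ‖∑' k : ℤ, z ^ k * f k‖ ≤ K * ε ^ N * ((b - a + N + 1) / ε) := by
    calc _ ≤ ‖z - 1‖ ^ N * ‖∑' k : ℤ, z ^ k * f k‖ := by gcongr
      _ ≤ _ := key
      _ ≤ _ := by
        gcongr
        rw [le_div_iff₀ hε]
        have : (b / ε - a / ε + N + 1) * ε = b - a + (N + 1) * ε := by field_simp; ring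
        rw [this]
        nlinarith [(Nat.cast_nonneg N : (0 : ℝ) ≤ N)]
  have h2 : (ε / δ) ^ N ≤ (ε / δ) ^ L := by
    rw [← Real.rpow_natCast]
    exact Real.rpow_le_rpow_of_exponent_ge (by positivity) ((div_le_one hδ0).2 hεδ) hN
  have h3 : (ε / δ) ^ L / ε = ε ^ (L - 1) / δ ^ L := by
    rw [Real.div_rpow hε.le hδ0.le, Real.rpow_sub_one hε.ne']
    field_simp
  calc ‖∑' k : ℤ, z ^ k * f k‖ ≤ K * ε ^ N * ((b - a + N + 1) / ε) / δ ^ N := by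
        rw [le_div_iff₀ (by positivity)]; linarith
    _ = K * (b - a + N + 1) * ((ε / δ) ^ N / ε) := by rw [div_pow]; field_simp
    _ ≤ K * (b - a + N + 1) * (ε ^ (L - 1) / δ ^ L) := by
        rw [← h3]; gcongr
    _ ≤ (K * (b - a + N + 1) + 1) * max (ε ^ (L - 1) / δ ^ L) 1 := by
        gcongr
        · linarith
        · exact le_max_left _ _
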